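/- Let β > 0 and F₀ > 4β be constants, and take supercritical external force F(N) = F₀·N. Then there exist a constant C > 0 and N₀ ∈ ℕ such that for all N ≥ N₀ and all integers 2 ≤ k ≤ N, the conditional variance satisfies 0 ≤ v_k(N, F₀N) ≤ C·(kN)^{−3/2}. -/

import Mathlib

open MeasureTheory Filter

noncomputable section

/-- The `k`-th spacing coordinate (for `1 ≤ k ≤ N`): for `k ≤ N-1` it is the
`k`-th coordinate of `x`, and for `k = N` it is `1 - (x_1 + ⋯ + x_{N-1})`. -/
def coulombCoord (N k : ℕ) (x : Fin (N - 1) → ℝ) : ℝ :=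
  if h : k - 1 < N - 1 then x ⟨k - 1, h⟩ else 1 - ∑ i, x i

/-- The open simplex `T_N ⊆ (0,1)^{N-1}`. -/
def coulombDomain (N : ℕ) : Set (Fin (N - 1) → ℝ) :=
  {x | (∀ i, 0 < x i ∧ x i < 1) ∧ ∑ i, x i < 1}

/-- `I_N[g] = ∫_{T_N} g · exp(−Σ_{i=1}^N (β/x_i + F·i·x_i))`. -/
def coulombInt (β F : ℝ) (N : ℕ) (g : (Fin (N - 1) → ℝ) → ℝ) : ℝ :=
  ∫ x in coulombDomain N,
    g x * Real.exp (-(∑ k ∈ Finset.Icc 1 N,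
      (β / coulombCoord N k x + F * (k : ℝ) * coulombCoord N k x)))

/-- Conditional mean `m_k(N,F)` of the `k`-th spacing. -/
def condMean (β : ℝ) (N : ℕ) (F : ℝ) (k : ℕ) : ℝ :=
  coulombInt β F N (coulombCoord N k) / coulombInt β F N (fun _ => 1)

/-- Conditional variance `v_k(N,F)` of the `k`-th spacing. -/
def condVar (β : ℝ) (N : ℕ) (F : ℝ) (k : ℕ) : ℝ :=
  coulombInt β F N (fun x => coulombCoord N k x ^ 2) / coulombInt β F N (fun _ => 1)
    - condMean β N F k ^ 2

/-- One-dimensional weight. -/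
def cw (β b x : ℝ) : ℝ := Real.exp (-(β / x + b * x))

lemma cw_pos (β b x : ℝ) : 0 < cw β b x := Real.exp_pos _

lemma cw_meas (β b : ℝ) : Measurable (cw β b) := by
  unfold cw; fun_prop

lemma cw_le {β b x : ℝ} (hβ : 0 < β) (hx : 0 < x) : cw β b x ≤ Real.exp (-b * x) := by
  unfold cw
  apply Real.exp_le_exp.mpr
  have : 0 < β / x := by positivity
  linarith

lemma cw_int {β b : ℝ} (hβ : 0 < β) (hb : 0 < b) (n : ℕ) :
    IntegrableOn (fun x => x ^ n * cw β b x) (Set.Ioi 0) := by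
  have h := integrableOn_rpow_mul_exp_neg_mul_rpow (p := 1) (s := n) (b := b)
    (by have : (0:ℝ) ≤ n := by positivity
        linarith) one_pos hb
  refine Integrable.mono' h ?_ ?_
  · exact ((measurable_id.pow_const n).mul (cw_meas β b)).aestronglyMeasurable
  · filter_upwards [ae_restrict_mem measurableSet_Ioi] with x hx
    have hx : 0 < x := hx
    rw [Real.norm_of_nonneg (mul_nonneg (pow_nonneg hx.le _) (cw_pos _ _ _).le)]
    simp only [Real.rpow_natCast, Real.rpow_one]
    exact mul_le_mul_of_nonneg_left (cw_le hβ hx) (pow_nonneg hx.le _)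

lemma cw_parts {β b : ℝ} (hβ : 0 < β) (hb : 0 < b) (n : ℕ) :
    (n + 2) * ∫ x in Set.Ioi 0, x ^ (n + 1) * cw β b x =
    b * (∫ x in Set.Ioi 0, x ^ (n + 2) * cw β b x) -
      β * ∫ x in Set.Ioi 0, x ^ n * cw β b x := by
  have key : ∫ x in Set.Ioi (0:ℝ), ((n + 2) * (x ^ (n + 1) * cw β b x)
      + β * (x ^ n * cw β b x) - b * (x ^ (n + 2) * cw β b x)) = 0 - 0 ^ (n + 2) * cw β b 0 := by
    refine integral_Ioi_of_hasDerivAt_of_tendsto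
      (f := fun x => x ^ (n + 2) * cw β b x) ?_ ?_ ?_ ?_
    · have h0 : Tendsto (fun x : ℝ => x ^ (n + 2)) (nhdsWithin 0 (Set.Ici 0)) (nhds 0) := by
        have : ContinuousAt (fun x : ℝ => x ^ (n + 2)) 0 := by fun_prop
        have h := this.tendsto
        simp only [ne_eq, Nat.add_eq_zero_iff, OfNat.ofNat_ne_zero, and_false, not_false_eq_true,
          zero_pow] at h
        exact h.mono_left nhdsWithin_le_nhds
      unfold ContinuousWithinAt
      simp only [ne_eq, Nat.add_eq_zero_iff, OfNat.ofNat_ne_zero, and_false, not_false_eq_true,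
          zero_pow, zero_mul]
      refine tendsto_of_tendsto_of_tendsto_of_le_of_le' tendsto_const_nhds h0 ?_ ?_
      · filter_upwards [self_mem_nhdsWithin] with x hx
        exact mul_nonneg (pow_nonneg hx _) (cw_pos _ _ _).le
      · filter_upwards [self_mem_nhdsWithin] with x hx
        have hx : 0 ≤ x := hx
        apply mul_le_of_le_one_right (pow_nonneg hx _)
        unfold cw
        apply Real.exp_le_one_iff.mpr
        have : 0 ≤ β / x + b * x := by positivity
        linarith
    · intro x hx
      have hx : 0 < x := hx
      have h1 := (hasDerivAt_pow (n + 2) x)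
      have h2 : HasDerivAt (fun x => cw β b x) (cw β b x * (-(-β / x ^ 2 + b))) x := by
        unfold cw
        apply HasDerivAt.exp
        apply HasDerivAt.neg
        apply HasDerivAt.add
        · have := (hasDerivAt_inv hx.ne').const_mul β
          simp only [div_eq_mul_inv]
          exact this.congr_deriv (by ring)
        · simpa using (hasDerivAt_id x).const_mul b
      refine (h1.mul h2).congr_deriv ?_
      simp only [Nat.add_succ_sub_one]
      push_cast
      field_simp
      ring
    · exact (((cw_int hβ hb (n + 1)).const_mul _).add ((cw_int hβ hb n).const_mul _)).sub
        ((cw_int hβ hb (n + 2)).const_mul _)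
    · have h0 := tendsto_rpow_mul_exp_neg_mul_atTop_nhds_zero (n + 2 : ℕ) b hb
      refine tendsto_of_tendsto_of_tendsto_of_le_of_le' tendsto_const_nhds h0 ?_ ?_
      · filter_upwards [eventually_gt_atTop 0] with x hx
        exact mul_nonneg (pow_nonneg hx.le _) (cw_pos _ _ _).le
      · filter_upwards [eventually_gt_atTop 0] with x hx
        simp only [Real.rpow_natCast]
        exact mul_le_mul_of_nonneg_left (cw_le hβ hx) (pow_nonneg hx.le _)
  rw [integral_sub, integral_add, integral_const_mul, integral_const_mul, integral_const_mul] at key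
  · simp only [ne_eq, Nat.add_eq_zero_iff, OfNat.ofNat_ne_zero, and_false, not_false_eq_true,
          zero_pow, zero_mul] at key
    linarith
  · exact ((cw_int hβ hb (n + 1)).const_mul _)
  · exact ((cw_int hβ hb n).const_mul _)
  · exact (((cw_int hβ hb (n + 1)).const_mul _).add ((cw_int hβ hb n).const_mul _))
  · exact ((cw_int hβ hb (n + 2)).const_mul _)

lemma cw_Z_pos {β b : ℝ} (hβ : 0 < β) (hb : 0 < b) : 0 < ∫ x in Set.Ioi 0, cw β b x := by
  have h := cw_int hβ hb 0
  simp only [pow_zero, one_mul] at h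
  rw [setIntegral_pos_iff_support_of_nonneg_ae (ae_of_all _ fun x => (cw_pos β b x).le) h]
  have : Function.support (fun x => cw β b x) = Set.univ := by
    ext x; simp [(cw_pos β b x).ne']
  rw [this]; simp

lemma cw_sq {β b : ℝ} (hβ : 0 < β) (hb : 0 < b) (t : ℝ) :
    ∫ x in Set.Ioi 0, (x - t) ^ 2 * cw β b x =
      (∫ x in Set.Ioi 0, x ^ 2 * cw β b x) - 2 * t * (∫ x in Set.Ioi 0, x ^ 1 * cw β b x)
      + t ^ 2 * ∫ x in Set.Ioi 0, x ^ 0 * cw β b x := by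
  rw [← integral_const_mul, ← integral_const_mul, ← integral_sub, ← integral_add]
  · congr 1; ext x; ring
  · exact (cw_int hβ hb 2).sub ((cw_int hβ hb 1).const_mul _)
  · exact ((cw_int hβ hb 0).const_mul _)
  · exact cw_int hβ hb 2
  · exact ((cw_int hβ hb 1).const_mul _)

lemma cw_cube {β b : ℝ} (hβ : 0 < β) (hb : 0 < b) (a : ℝ) :
    ∫ x in Set.Ioi 0, (x - a) ^ 2 * (x + a) * cw β b x =
      (∫ x in Set.Ioi 0, x ^ 3 * cw β b x) - a * (∫ x in Set.Ioi 0, x ^ 2 * cw β b x)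
       - a ^ 2 * (∫ x in Set.Ioi 0, x ^ 1 * cw β b x)
      + a ^ 3 * ∫ x in Set.Ioi 0, x ^ 0 * cw β b x := by
  rw [← integral_const_mul, ← integral_const_mul, ← integral_const_mul, ← integral_sub,
    ← integral_sub, ← integral_add]
  · congr 1; ext x; ring
  · exact ((cw_int hβ hb 3).sub ((cw_int hβ hb 2).const_mul _)).sub ((cw_int hβ hb 1).const_mul _)
  · exact ((cw_int hβ hb 0).const_mul _)
  · exact ((cw_int hβ hb 3).sub ((cw_int hβ hb 2).const_mul _))
  · exact ((cw_int hβ hb 1).const_mul _)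
  · exact cw_int hβ hb 3
  · exact ((cw_int hβ hb 2).const_mul _)

lemma cw_sq_int {β b : ℝ} (hβ : 0 < β) (hb : 0 < b) (a : ℝ) :
    IntegrableOn (fun x => (x - a) ^ 2 * cw β b x) (Set.Ioi 0) := by
  have h := (((cw_int hβ hb 2).sub ((cw_int hβ hb 1).const_mul (2 * a)))).add
    ((cw_int hβ hb 0).const_mul (a ^ 2))
  refine h.congr (ae_of_all _ fun x => ?_)
  simp only [Pi.add_apply, Pi.sub_apply]; ring

lemma cw_cube_int {β b : ℝ} (hβ : 0 < β) (hb : 0 < b) (a : ℝ) :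
    IntegrableOn (fun x => (x - a) ^ 2 * (x + a) * cw β b x) (Set.Ioi 0) := by
  have h := (((cw_int hβ hb 3).sub ((cw_int hβ hb 2).const_mul a)).sub
    ((cw_int hβ hb 1).const_mul (a ^ 2))).add ((cw_int hβ hb 0).const_mul (a ^ 3))
  refine h.congr (ae_of_all _ fun x => ?_)
  simp only [Pi.add_apply, Pi.sub_apply]; ring

lemma cw_main {β b a : ℝ} (hβ : 0 < β) (hb : 0 < b) (ha : 0 < a) (hab : a ^ 2 * b = β)
    (h1 : 1 ≤ a * b) :
    (∫ x in Set.Ioi 0, x * cw β b x) ≤ (a + 2 / b) * (∫ x in Set.Ioi 0, cw β b x) ∧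
    (∫ x in Set.Ioi 0, (x - a) ^ 2 * cw β b x) ≤ (21 * a / b) * ∫ x in Set.Ioi 0, cw β b x := by
  have hZ := cw_Z_pos hβ hb
  have p0 := cw_parts hβ hb 0
  have p1 := cw_parts hβ hb 1
  have hcs : 0 ≤ ∫ x in Set.Ioi 0, (x - ((∫ x in Set.Ioi 0, x ^ 1 * cw β b x) /
      ∫ x in Set.Ioi 0, cw β b x)) ^ 2 * cw β b x :=
    integral_nonneg fun x => mul_nonneg (sq_nonneg _) (cw_pos _ _ _).le
  rw [cw_sq hβ hb] at hcs
  have hcube : a * ∫ x in Set.Ioi 0, (x - a) ^ 2 * cw β b x ≤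
      ∫ x in Set.Ioi 0, (x - a) ^ 2 * (x + a) * cw β b x := by
    rw [← integral_const_mul]
    refine setIntegral_mono_on ((cw_sq_int hβ hb a).const_mul _) (cw_cube_int hβ hb a)
      measurableSet_Ioi fun x hx => ?_
    have hx : 0 < x := hx
    have := mul_nonneg (mul_nonneg (sq_nonneg (x - a)) hx.le) (cw_pos β b x).le
    nlinarith
  rw [cw_cube hβ hb] at hcube
  have h1nn : 0 ≤ ∫ x in Set.Ioi 0, x ^ 1 * cw β b x :=
    setIntegral_nonneg measurableSet_Ioi fun x (hx : 0 < x) =>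
      mul_nonneg (by simpa using hx.le) (cw_pos _ _ _).le
  generalize (∫ x in Set.Ioi 0, (x - a) ^ 2 * cw β b x) = V at *
  norm_num at p0 p1 hcs hcube h1nn ⊢
  generalize (∫ x in Set.Ioi 0, cw β b x) = Z at *
  generalize (∫ x in Set.Ioi 0, x * cw β b x) = Z1 at *
  generalize (∫ x in Set.Ioi 0, x ^ 2 * cw β b x) = Z2 at *
  generalize (∫ x in Set.Ioi 0, x ^ 3 * cw β b x) = Z3 at *
  obtain ⟨e1, rfl⟩ : ∃ e, Z1 = e * Z := ⟨Z1 / Z, by field_simp⟩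
  obtain ⟨e2, rfl⟩ : ∃ e, Z2 = e * Z := ⟨Z2 / Z, by field_simp⟩
  obtain ⟨e3, rfl⟩ : ∃ e, Z3 = e * Z := ⟨Z3 / Z, by field_simp⟩
  obtain ⟨v, rfl⟩ : ∃ e, V = e * Z := ⟨V / Z, by field_simp⟩
  have e1nn : 0 ≤ e1 := nonneg_of_mul_nonneg_left h1nn hZ
  have q0 : 2 * e1 = b * e2 - β := by
    apply mul_right_cancel₀ hZ.ne'; linarith
  have q1 : 3 * e2 = b * e3 - β * e1 := by
    apply mul_right_cancel₀ hZ.ne'; linarith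
  have qc : e1 ^ 2 ≤ e2 := by
    have : e1 * Z / Z = e1 := by field_simp
    rw [this] at hcs
    apply le_of_mul_le_mul_right _ hZ; nlinarith
  have qv : a * v ≤ e3 - a * e2 - a ^ 2 * e1 + a ^ 3 := by
    apply le_of_mul_le_mul_right _ hZ; nlinarith
  obtain ⟨r, hr⟩ : ∃ r, r = 1 / b := ⟨_, rfl⟩
  have hrb : r * b = 1 := by rw [hr]; field_simp
  have hr0 : 0 < r := by rw [hr]; positivity
  have hra : r ≤ a := by
    have : r * 1 ≤ r * (a * b) := by gcongr
    nlinarith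
  have he2 : e2 = a ^ 2 + 2 * e1 * r := by
    have : r * (2 * e1) = r * (b * e2 - β) := by rw [q0]
    rw [← hab] at this
    linear_combination -this + (a^2 - e2) * hrb
  have he3 : e3 = 3 * e2 * r + a ^ 2 * e1 := by
    have : r * (3 * e2) = r * (b * e3 - β * e1) := by rw [q1]
    rw [← hab] at this
    linear_combination -this + (a^2*e1 - e3) * hrb
  have he1 : e1 ≤ a + 2 * r := by
    have : (e1 - r) ^ 2 ≤ (a + r) ^ 2 := by nlinarith [mul_pos ha hr0]
    have := abs_le_of_sq_le_sq this (by positivity)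
    linarith [(abs_le.mp this).2]
  have hv : v ≤ 21 * a * r := by
    have h7 : e2 ≤ 7 * a ^ 2 := by
      rw [he2]
      have : e1 ≤ 3 * a := by linarith
      have : e1 * r ≤ (3 * a) * a := by gcongr
      nlinarith
    apply le_of_mul_le_mul_left _ ha
    have : e2 * r ≤ 7 * a ^ 2 * r := by gcongr
    have : 0 ≤ a * (e1 * r) := by positivity
    have h8: a * v ≤ 3 * e2 * r - a * (2 * e1 * r) := by rw [he3, he2] at qv; rw [he2]; linarith
    nlinarith
  have e21 : 21 * a / b = 21 * a * r := by rw [hr]; ring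
  have e22 : 2 / b = 2 * r := by rw [hr]; ring
  rw [e21, e22]
  exact ⟨mul_le_mul_of_nonneg_right he1 hZ.le, mul_le_mul_of_nonneg_right hv hZ.le⟩

lemma prod_upd {ι : Type*} [Fintype ι] [DecidableEq ι] (w : ι → ℝ → ℝ) (g : ℝ → ℝ) (j : ι)
    (u : ι → ℝ) :
    g (u j) * ∏ i, w i (u i) = ∏ i, ((if i = j then g (u i) else 1) * w i (u i)) := by
  rw [Finset.prod_mul_distrib]; simp

/-- Product measure on the positive orthant. -/
def posPi (ι : Type*) [Fintype ι] : Measure (ι → ℝ) :=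
  Measure.pi (fun _ => volume.restrict (Set.Ioi (0:ℝ)))

lemma posPi_eq (ι : Type*) [Fintype ι] :
    posPi ι = volume.restrict {u : ι → ℝ | ∀ i, 0 < u i} := by
  unfold posPi
  rw [← Measure.restrict_pi_pi]
  congr 1
  ext u; simp

lemma prod_integrable {ι : Type*} [Fintype ι] [DecidableEq ι] (w : ι → ℝ → ℝ) (g : ℝ → ℝ) (j : ι)
    (hw : ∀ i, IntegrableOn (w i) (Set.Ioi 0))
    (hg : IntegrableOn (fun x => g x * w j x) (Set.Ioi 0)) :
    Integrable (fun u : ι → ℝ => g (u j) * ∏ i, w i (u i)) (posPi ι) := by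
  simp_rw [prod_upd w g j]
  unfold posPi
  refine Integrable.fintype_prod_dep (f := fun i x => (if i = j then g x else 1) * w i x) ?_
  intro i
  by_cases h : i = j
  · subst h; simpa [IntegrableOn] using hg
  · simpa [h, IntegrableOn] using hw i

lemma prod_integral {ι : Type*} [Fintype ι] [DecidableEq ι] (w : ι → ℝ → ℝ) (g : ℝ → ℝ) (j : ι)
    (hw : ∀ i, 0 < ∫ x in Set.Ioi 0, w i x) (M : ℝ)
    (hM : (∫ x in Set.Ioi 0, g x * w j x) ≤ M * ∫ x in Set.Ioi 0, w j x) :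
    ∫ u, g (u j) * ∏ i, w i (u i) ∂(posPi ι) ≤ M * ∏ i, ∫ x in Set.Ioi 0, w i x := by
  simp_rw [prod_upd w g j]
  unfold posPi
  rw [integral_fintype_prod_eq_prod (fun i x => (if i = j then g x else 1) * w i x)]
  rw [← Finset.mul_prod_erase _ _ (Finset.mem_univ j),
    ← Finset.mul_prod_erase (a := j) (f := fun i => ∫ x in Set.Ioi 0, w i x) _ (Finset.mem_univ j)]
  have : ∏ i ∈ Finset.univ.erase j, ∫ x in Set.Ioi 0, (if i = j then g x else 1) * w i x
      = ∏ i ∈ Finset.univ.erase j, ∫ x in Set.Ioi 0, w i x := by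
    refine Finset.prod_congr rfl fun i hi => ?_
    simp [(Finset.mem_erase.mp hi).1]
  rw [this, ← mul_assoc]
  simp only [if_true]
  exact mul_le_mul_of_nonneg_right hM (Finset.prod_nonneg fun i _ => (hw i).le)

lemma orth_meas (ι : Type*) [Fintype ι] : MeasurableSet {u : ι → ℝ | ∀ i, 0 < u i} := by
  rw [Set.ofPred_forall]
  exact MeasurableSet.iInter fun i => measurableSet_lt measurable_const (measurable_pi_apply i)

/-- the simplex domain -/
def spx (ι : Type*) [Fintype ι] : Set (ι → ℝ) := {u | (∀ i, 0 < u i) ∧ ∑ i, u i < 1}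

lemma spx_meas (ι : Type*) [Fintype ι] : MeasurableSet (spx ι) := by
  unfold spx
  have h1 := orth_meas ι
  have h2 : MeasurableSet {u : ι → ℝ | ∑ i, u i < 1} :=
    measurableSet_lt (by fun_prop) measurable_const
  exact h1.inter h2

/-- the reduced weight -/
def redW {ι : Type*} [Fintype ι] (β : ℝ) (b : ι → ℝ) (u : ι → ℝ) : ℝ :=
  Real.exp (-(β / (1 - ∑ i, u i))) * ∏ i, cw β (b i) (u i)

lemma redW_pos {ι : Type*} [Fintype ι] (β : ℝ) (b : ι → ℝ) (u : ι → ℝ) : 0 < redW β b u :=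
  mul_pos (Real.exp_pos _) (Finset.prod_pos fun i _ => cw_pos _ _ _)

lemma redW_meas {ι : Type*} [Fintype ι] (β : ℝ) (b : ι → ℝ) : Measurable (redW β b) := by
  unfold redW cw
  fun_prop

lemma redW_le {ι : Type*} [Fintype ι] {β : ℝ} (hβ : 0 < β) (b : ι → ℝ) {u : ι → ℝ}
    (hu : u ∈ spx ι) : redW β b u ≤ ∏ i, cw β (b i) (u i) := by
  unfold redW
  apply mul_le_of_le_one_left (Finset.prod_nonneg fun i _ => (cw_pos _ _ _).le)
  apply Real.exp_le_one_iff.mpr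
  have : 0 < 1 - ∑ i, u i := by linarith [hu.2]
  have : 0 < β / (1 - ∑ i, u i) := by positivity
  linarith

lemma restr_simp (ι : Type*) [Fintype ι] :
    (posPi ι).restrict (spx ι) = volume.restrict (spx ι) := by
  rw [posPi_eq, Measure.restrict_restrict (spx_meas ι)]
  congr 1
  ext u; simp only [spx, Set.mem_inter_iff, Set.mem_ofPred_eq]; tauto

lemma redW_integrable {ι : Type*} [Fintype ι] [DecidableEq ι] {β : ℝ} (hβ : 0 < β) (b : ι → ℝ)
    (j : ι) (g : ℝ → ℝ) (hgm : Measurable g)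
    (hw : ∀ i, IntegrableOn (cw β (b i)) (Set.Ioi 0))
    (hg : IntegrableOn (fun x => g x * cw β (b j) x) (Set.Ioi 0)) :
    IntegrableOn (fun u => g (u j) * redW β b u) (spx ι) := by
  have h := (prod_integrable (fun i => cw β (b i)) g j hw hg).integrableOn (s := spx ι)
  unfold IntegrableOn at h ⊢
  rw [restr_simp] at h
  refine h.norm.mono' ?_ ?_
  · exact ((hgm.comp (measurable_pi_apply j)).mul (redW_meas β b)).aestronglyMeasurable
  · filter_upwards [ae_restrict_mem (spx_meas ι)] with u hu
    rw [norm_mul, norm_mul]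
    refine mul_le_mul_of_nonneg_left ?_ (norm_nonneg _)
    rw [Real.norm_of_nonneg (redW_pos β b u).le,
      Real.norm_of_nonneg (Finset.prod_nonneg fun i _ => (cw_pos _ _ _).le)]
    exact redW_le hβ b hu

lemma redW_upper {ι : Type*} [Fintype ι] [DecidableEq ι] {β : ℝ} (hβ : 0 < β) (b : ι → ℝ)
    (hb : ∀ i, 0 < b i) (j : ι) (a M : ℝ)
    (hM : (∫ x in Set.Ioi 0, (x - a) ^ 2 * cw β (b j) x) ≤ M * ∫ x in Set.Ioi 0, cw β (b j) x) :
    ∫ u in spx ι, (u j - a) ^ 2 * redW β b u ≤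
      M * ∏ i, ∫ x in Set.Ioi 0, cw β (b i) x := by
  have hw : ∀ i, IntegrableOn (cw β (b i)) (Set.Ioi 0) := fun i => by
    simpa using cw_int hβ (hb i) 0
  refine le_trans ?_ (prod_integral (fun i => cw β (b i)) (fun x => (x - a) ^ 2) j
    (fun i => cw_Z_pos hβ (hb i)) M hM)
  have hI := prod_integrable (fun i => cw β (b i)) (fun x => (x - a) ^ 2) j hw
    (cw_sq_int hβ (hb j) a)
  refine le_trans ?_ (setIntegral_le_integral (s := spx ι) hI (ae_of_all _ fun u =>
    mul_nonneg (sq_nonneg _) (Finset.prod_nonneg fun i _ => (cw_pos _ _ _).le)))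
  have hI2 := hI.integrableOn (s := spx ι)
  unfold IntegrableOn at hI2
  rw [restr_simp] at hI2 ⊢
  refine setIntegral_mono_on (redW_integrable hβ b j (fun x => (x - a) ^ 2) (by fun_prop) hw
    (cw_sq_int hβ (hb j) a)) hI2 (spx_meas ι) fun u hu => ?_
  exact mul_le_mul_of_nonneg_left (redW_le hβ b hu) (sq_nonneg _)

lemma redW_lower {ι : Type*} [Fintype ι] [DecidableEq ι] [Nonempty ι] {β δ : ℝ} (hβ : 0 < β)
    (b m : ι → ℝ)
    (hb : ∀ i, 0 < b i) (hδ : 0 < δ) (hδ1 : δ < 1)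
    (hm : ∀ i, (∫ x in Set.Ioi 0, x * cw β (b i) x) ≤ m i * ∫ x in Set.Ioi 0, cw β (b i) x)
    (hs : ∑ i, m i ≤ 1 - 2 * δ) :
    Real.exp (-(β / δ)) * δ * ∏ i, ∫ x in Set.Ioi 0, cw β (b i) x ≤
    ∫ u in spx ι, 1 * redW β b u := by
  have hw : ∀ i, IntegrableOn (cw β (b i)) (Set.Ioi 0) := fun i => by
    simpa using cw_int hβ (hb i) 0
  have hw1 : ∀ i, IntegrableOn (fun x => x * cw β (b i) x) (Set.Ioi 0) := fun i => by
    simpa using cw_int hβ (hb i) 1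
  obtain ⟨j⟩ := ‹Nonempty ι›
  have hZ : 0 < ∏ i, ∫ x in Set.Ioi 0, cw β (b i) x :=
    Finset.prod_pos fun i _ => cw_Z_pos hβ (hb i)
  set Z := ∏ i, ∫ x in Set.Ioi 0, cw β (b i) x with hZdef
  have hP0 : ∫ u, ∏ i, cw β (b i) (u i) ∂(posPi ι) = Z := by
    unfold posPi
    rw [integral_fintype_prod_eq_prod (fun i x => cw β (b i) x)]
  have hI0 : Integrable (fun u : ι → ℝ => ∏ i, cw β (b i) (u i)) (posPi ι) := by
    simpa using prod_integrable (fun i => cw β (b i)) (fun _ => 1) j hw (by simpa using hw j)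
  have hIi : ∀ i, Integrable (fun u : ι → ℝ => u i * ∏ i, cw β (b i) (u i)) (posPi ι) := fun i =>
    prod_integrable (fun i => cw β (b i)) (fun x => x) i hw (hw1 i)
  have hPi : ∀ i, ∫ u, u i * ∏ i, cw β (b i) (u i) ∂(posPi ι) ≤ m i * Z := fun i =>
    prod_integral (fun i => cw β (b i)) (fun x => x) i (fun i => cw_Z_pos hβ (hb i)) _ (hm i)
  have hδ' : 0 < 1 - δ := by linarith
  have hIF : Integrable (fun u : ι → ℝ => ∏ i, cw β (b i) (u i) -
      (1 - δ)⁻¹ * ∑ k, u k * ∏ i, cw β (b i) (u i)) (posPi ι) :=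
    hI0.sub ((integrable_finsetSum _ fun i _ => hIi i).const_mul _)
  have hF : δ * Z ≤ ∫ u, (∏ i, cw β (b i) (u i) -
      (1 - δ)⁻¹ * ∑ k, u k * ∏ i, cw β (b i) (u i)) ∂(posPi ι) := by
    rw [integral_sub hI0 ((integrable_finsetSum _ fun i _ => hIi i).const_mul _), hP0,
      integral_const_mul, integral_finsetSum _ fun i _ => hIi i]
    have h1 : ∑ k, ∫ u, u k * ∏ i, cw β (b i) (u i) ∂(posPi ι) ≤ (1 - 2 * δ) * Z := by
      calc _ ≤ ∑ k, m k * Z := Finset.sum_le_sum fun i _ => hPi i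
        _ = (∑ k, m k) * Z := by rw [Finset.sum_mul]
        _ ≤ _ := mul_le_mul_of_nonneg_right hs hZ.le
    have h2 : (1 - δ)⁻¹ * ∑ k, ∫ u, u k * ∏ i, cw β (b i) (u i) ∂(posPi ι) ≤
        (1 - δ)⁻¹ * ((1 - 2 * δ) * Z) := by gcongr
    have h3 : (1 - δ)⁻¹ * (1 - 2 * δ) ≤ 1 - δ := by
      rw [inv_mul_le_iff₀ hδ']; nlinarith
    have := mul_le_mul_of_nonneg_right h3 hZ.le
    linarith
  have hset : ∫ u in spx ι, 1 * redW β b u =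
      ∫ u, (spx ι).indicator (fun u => redW β b u) u ∂(posPi ι) := by
    rw [integral_indicator (spx_meas ι), restr_simp]; simp
  have hIr : Integrable ((spx ι).indicator (fun u => redW β b u)) (posPi ι) := by
    rw [integrable_indicator_iff (spx_meas ι)]
    unfold IntegrableOn
    rw [restr_simp]
    simpa [IntegrableOn] using redW_integrable hβ b j (fun _ => 1) (by fun_prop) hw (by simpa using hw j)
  rw [hset, mul_assoc]
  refine le_trans (mul_le_mul_of_nonneg_left hF (Real.exp_pos _).le) ?_
  rw [← integral_const_mul]
  refine integral_mono_ae (hIF.const_mul _) hIr ?_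
  have hae : ∀ᵐ u ∂(posPi ι), ∀ i, 0 < u i := by
    rw [posPi_eq]
    exact ae_restrict_mem (orth_meas ι)
  filter_upwards [hae] with u hu
  have hP : 0 < ∏ i, cw β (b i) (u i) := Finset.prod_pos fun i _ => cw_pos _ _ _
  have e : ∏ i, cw β (b i) (u i) - (1 - δ)⁻¹ * ∑ k, u k * ∏ i, cw β (b i) (u i) =
      (1 - (1 - δ)⁻¹ * ∑ k, u k) * ∏ i, cw β (b i) (u i) := by
    rw [← Finset.sum_mul]; ring
  rw [e]
  have hS : 0 ≤ ∑ k, u k := Finset.sum_nonneg fun i _ => (hu i).le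
  by_cases h : ∑ k, u k ≤ 1 - δ
  · rw [Set.indicator_of_mem (show u ∈ spx ι from ⟨hu, by linarith⟩)]
    unfold redW
    have h1 : Real.exp (-(β / δ)) ≤ Real.exp (-(β / (1 - ∑ i, u i))) := by
      apply Real.exp_le_exp.mpr
      apply neg_le_neg
      apply div_le_div_of_nonneg_left hβ.le hδ
      linarith
    have h2 : (1 - (1 - δ)⁻¹ * ∑ k, u k) ≤ 1 := by
      have : 0 ≤ (1 - δ)⁻¹ * ∑ k, u k := by positivity
      linarith
    have h3 := mul_le_of_le_one_left hP.le h2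
    calc _ ≤ Real.exp (-(β / δ)) * ∏ i, cw β (b i) (u i) := by gcongr
      _ ≤ _ := by gcongr
  · have h1 : (1 - (1 - δ)⁻¹ * ∑ k, u k) ≤ 0 := by
      have : 1 ≤ (1 - δ)⁻¹ * ∑ k, u k := by
        rw [le_inv_mul_iff₀ hδ']; linarith
      linarith
    have h2 : 0 ≤ (spx ι).indicator (fun u => redW β b u) u :=
      Set.indicator_nonneg (fun u _ => (redW_pos β b u).le) u
    refine le_trans ?_ h2
    apply mul_nonpos_of_nonneg_of_nonpos (Real.exp_pos _).le
    exact mul_nonpos_of_nonpos_of_nonneg h1 hP.le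

/-- linear part of the exchange map -/
def exL (n : ℕ) : (Fin (n + 1) → ℝ) →ₗ[ℝ] (Fin (n + 1) → ℝ) where
  toFun u := fun i => if i = 0 then -∑ k, u k else u i
  map_add' u v := by
    ext i
    by_cases h : i = 0
    · simp only [h, if_true, Pi.add_apply, Finset.sum_add_distrib]; ring
    · simp [h]
  map_smul' c u := by
    ext i
    by_cases h : i = 0
    · simp [h, Finset.mul_sum]
    · simp [h]

/-- exchange map -/
def exF (n : ℕ) (u : Fin (n + 1) → ℝ) : Fin (n + 1) → ℝ :=
  fun i => if i = 0 then 1 - ∑ k, u k else u i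

lemma exL_invol (n : ℕ) : exL n * exL n = 1 := by
  ext1 u
  apply LinearMap.ext
  intro c
  ext i
  simp only [exL]
  by_cases h : i = 0
  · subst h; simp [Fin.sum_univ_succ]
  · simp [h]

lemma exF_sum (n : ℕ) (u : Fin (n + 1) → ℝ) : ∑ k, exF n u k = 1 - u 0 := by
  simp [exF, Fin.sum_univ_succ]
  ring

lemma exF_invol (n : ℕ) : Function.Involutive (exF n) := by
  intro u
  ext i
  by_cases h : i = 0
  · subst h
    have := exF_sum n u
    simp only [exF, if_true] at this ⊢
    rw [this]; ring
  · simp [exF, h]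

lemma exF_mp (n : ℕ) : MeasurePreserving (exF n) volume volume := by
  have hdet : LinearMap.det (exL n) * LinearMap.det (exL n) = 1 := by
    rw [← map_mul, exL_invol, map_one]
  have hne : LinearMap.det (exL n) ≠ 0 := by
    intro h; rw [h] at hdet; simp at hdet
  have h1 : MeasurePreserving (exL n) volume volume := by
    refine ⟨(exL n).continuous_of_finiteDimensional.measurable, ?_⟩
    rw [Real.map_linearMap_volume_pi_eq_smul_volume_pi hne]
    have : |(LinearMap.det (exL n))⁻¹| = 1 := by
      rcases mul_self_eq_one_iff.mp hdet with h | h <;> simp [h]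
    simp [this]
  have h2 := (measurePreserving_add_left (volume : Measure (Fin (n + 1) → ℝ))
    (Pi.single 0 1)).comp h1
  convert h2 using 1
  ext u i
  by_cases h : i = 0
  · subst h; simp [exF, exL]; ring
  · simp [exF, exL, h]

/-- exchange map as an equivalence -/
def exE (n : ℕ) : (Fin (n + 1) → ℝ) ≃ᵐ (Fin (n + 1) → ℝ) where
  toEquiv := (exF_invol n).toPerm
  measurable_toFun := (exF_mp n).measurable
  measurable_invFun := (exF_mp n).measurable

/-- the reduced force coefficients -/
def cc (n : ℕ) (i : Fin (n + 1)) : ℝ := if i = 0 then (n : ℝ) + 1 else (i : ℕ)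

lemma cc_sum (n : ℕ) (f : ℝ → ℝ) :
    ∑ i, f (cc n i) = ∑ j ∈ Finset.range (n + 1), f (j + 1) := by
  rw [Fin.sum_univ_succ, Finset.sum_range_succ, Finset.sum_range, add_comm]
  simp [cc]

lemma dom_eq (n : ℕ) : coulombDomain (n + 2) = spx (Fin (n + 1)) := by
  ext x
  constructor
  · rintro ⟨h1, h2⟩
    exact ⟨fun i => (h1 i).1, h2⟩
  · rintro ⟨h1, h2⟩
    refine ⟨fun i => ⟨h1 i, ?_⟩, h2⟩
    exact lt_of_le_of_lt (Finset.single_le_sum (f := x) (fun i _ => (h1 i).le)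
      (Finset.mem_univ i)) h2

lemma exF_pre (n : ℕ) : exF n ⁻¹' spx (Fin (n + 1)) = spx (Fin (n + 1)) := by
  have key : ∀ u, u ∈ spx (Fin (n + 1)) → exF n u ∈ spx (Fin (n + 1)) := by
    rintro u ⟨h1, h2⟩
    refine ⟨fun i => ?_, ?_⟩
    · by_cases h : i = 0
      · simp only [exF, h, if_true]; linarith
      · simpa [exF, h] using h1 i
    · rw [exF_sum]; linarith [h1 0]
  ext u
  constructor
  · intro h
    have := key _ h
    rwa [exF_invol n u] at this
  · exact key u

lemma coord_one (n : ℕ) (u : Fin (n + 1) → ℝ) :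
    coulombCoord (n + 2) 1 (exF n u) = 1 - ∑ i, u i := by
  unfold coulombCoord
  rw [dif_pos (by omega)]
  simp [exF]

lemma coord_last (n : ℕ) (u : Fin (n + 1) → ℝ) :
    coulombCoord (n + 2) (n + 2) (exF n u) = u 0 := by
  unfold coulombCoord
  rw [dif_neg (by omega)]
  have := exF_sum n u
  change 1 - ∑ i : Fin (n + 1), exF n u i = u 0
  rw [this]; ring

lemma coord_mid (n : ℕ) (u : Fin (n + 1) → ℝ) (i : Fin n) :
    coulombCoord (n + 2) (i + 2) (exF n u) = u i.succ := by
  unfold coulombCoord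
  have : (i : ℕ) + 2 - 1 < n + 2 - 1 := by omega
  rw [dif_pos this]
  have e : (⟨(i : ℕ) + 2 - 1, this⟩ : Fin (n + 1)) = i.succ := by
    ext; simp
  change exF n u ⟨(i : ℕ) + 2 - 1, this⟩ = _
  rw [e]; simp [exF]

lemma coord_gen (n k : ℕ) (h2 : 2 ≤ k) (hk : k ≤ n + 2) :
    ∃ j : Fin (n + 1), cc n j = (k : ℝ) - 1 ∧
      ∀ u, coulombCoord (n + 2) k (exF n u) = u j := by
  rcases hk.eq_or_lt with rfl | h
  · exact ⟨0, by simp [cc]; ring, coord_last n⟩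
  · refine ⟨(⟨k - 2, by omega⟩ : Fin n).succ, ?_, fun u => ?_⟩
    · obtain ⟨l, rfl⟩ := Nat.exists_eq_add_of_le h2
      simp [cc]; ring
    · have h := coord_mid n u ⟨k - 2, by omega⟩
      have e : k - 2 + 2 = k := by omega
      simp only [e] at h
      exact h

lemma weight_eq (β F : ℝ) (n : ℕ) (u : Fin (n + 1) → ℝ) :
    Real.exp (-(∑ k ∈ Finset.Icc 1 (n + 2), (β / coulombCoord (n + 2) k (exF n u)
      + F * (k : ℝ) * coulombCoord (n + 2) k (exF n u)))) =
    Real.exp (-F) * redW β (fun i => F * cc n i) u := by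
  unfold redW cw
  rw [← Real.exp_sum, ← Real.exp_add, ← Real.exp_add]
  congr 1
  have e : Finset.Icc 1 (n + 2) = Finset.Ico 1 (n + 3) := by ext; simp; omega
  rw [e, Finset.sum_Ico_eq_sum_range]
  rw [show n + 3 - 1 = n + 1 + 1 by omega, Finset.sum_range_succ, Finset.sum_range_succ',
    Finset.sum_range, add_comm 1 (n + 1)]
  have e4 := coord_last n u
  rw [show 1 + 0 = 1 from rfl, coord_one, e4]
  have e2 : ∀ i : Fin n, 1 + ((i : ℕ) + 1) = i + 2 := fun i => by omega
  simp_rw [e2, coord_mid]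
  rw [Finset.sum_neg_distrib, Fin.sum_univ_succ (n := n) (f := fun i => β / u i + F * cc n i * u i)]
  simp only [cc, if_true, Fin.succ_ne_zero, if_false, Fin.val_succ]
  rw [Fin.sum_univ_succ (n := n) (f := u)]
  push_cast
  have e3 : ∑ i : Fin n, (β / u i.succ + F * ((i : ℕ) + 2 : ℝ) * u i.succ) =
      ∑ i : Fin n, (β / u i.succ + F * ((i : ℕ) + 1 : ℝ) * u i.succ) + F * ∑ i : Fin n, u i.succ := by
    rw [Finset.mul_sum, ← Finset.sum_add_distrib]
    exact Finset.sum_congr rfl fun i _ => by ring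
  rw [e3]; ring

lemma int_eq (β F : ℝ) (n : ℕ) (g : (Fin (n + 1) → ℝ) → ℝ) :
    coulombInt β F (n + 2) g =
      Real.exp (-F) * ∫ u in spx (Fin (n + 1)), g (exF n u) * redW β (fun i => F * cc n i) u := by
  unfold coulombInt
  rw [dom_eq]
  have h := (exF_mp n).setIntegral_preimage_emb (exE n).measurableEmbedding
    (fun x => g x * Real.exp (-(∑ k ∈ Finset.Icc 1 (n + 2),
      (β / coulombCoord (n + 2) k x + F * (k : ℝ) * coulombCoord (n + 2) k x))))
    (spx (Fin (n + 1)))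
  rw [exF_pre] at h
  refine h.symm.trans ?_
  rw [← integral_const_mul]
  congr 1
  ext u
  simp only [weight_eq]
  ring

lemma inv_sqrt_sum (m : ℕ) :
    ∑ j ∈ Finset.range m, 1 / Real.sqrt ((j : ℝ) + 1) ≤ 2 * Real.sqrt m := by
  induction m with
  | zero => simp
  | succ m ih =>
    rw [Finset.sum_range_succ]
    push_cast
    have h1 : 0 < Real.sqrt ((m : ℝ) + 1) := Real.sqrt_pos.mpr (by positivity)
    have h2 := Real.sq_sqrt (show (0:ℝ) ≤ (m : ℝ) + 1 by positivity)
    have h3 := Real.sq_sqrt (show (0:ℝ) ≤ (m : ℝ) by positivity)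
    have h4 : 1 / Real.sqrt ((m : ℝ) + 1) ≤ 2 * Real.sqrt ((m : ℝ) + 1) - 2 * Real.sqrt m := by
      rw [div_le_iff₀ h1]
      nlinarith [sq_nonneg (Real.sqrt ((m : ℝ) + 1) - Real.sqrt m)]
    linarith

lemma mean_sum {β F₀ : ℝ} (hβ : 0 < β) (hF : 0 < F₀) (n : ℕ) :
    ∑ i, (Real.sqrt (β / (F₀ * (n + 2 : ℕ) * cc n i)) + 2 / (F₀ * (n + 2 : ℕ) * cc n i)) ≤
      2 * Real.sqrt (β / F₀) + 4 / (F₀ * Real.sqrt (n + 2 : ℕ)) := by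
  rw [cc_sum n (fun c => Real.sqrt (β / (F₀ * (n + 2 : ℕ) * c)) + 2 / (F₀ * (n + 2 : ℕ) * c))]
  have hN : (0:ℝ) < (n + 2 : ℕ) := by positivity
  generalize hNN : ((n + 2 : ℕ) : ℝ) = N at *
  have hs : 0 < Real.sqrt N := Real.sqrt_pos.mpr hN
  have hs2 := Real.sq_sqrt hN.le
  have step : ∀ j ∈ Finset.range (n + 1), Real.sqrt (β / (F₀ * N * ((j : ℝ) + 1)))
      + 2 / (F₀ * N * ((j : ℝ) + 1)) ≤
      (Real.sqrt (β / F₀) / Real.sqrt N + 2 / (F₀ * N)) * (1 / Real.sqrt ((j : ℝ) + 1)) := by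
    intro j _
    have hj : (0:ℝ) < (j : ℝ) + 1 := by positivity
    have hj1 : 1 ≤ Real.sqrt ((j : ℝ) + 1) := by
      rw [Real.one_le_sqrt]; have : (0:ℝ) ≤ j := by positivity
      linarith
    have hj2 := Real.sq_sqrt hj.le
    have e1 : Real.sqrt (β / (F₀ * N * ((j : ℝ) + 1))) =
        Real.sqrt (β / F₀) / Real.sqrt N * (1 / Real.sqrt ((j : ℝ) + 1)) := by
      rw [show β / (F₀ * N * ((j : ℝ) + 1)) = β / F₀ / N / ((j : ℝ) + 1) by field_simp,
        Real.sqrt_div (by positivity), Real.sqrt_div (by positivity)]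
      ring
    have e2 : 2 / (F₀ * N * ((j : ℝ) + 1)) ≤ 2 / (F₀ * N) * (1 / Real.sqrt ((j : ℝ) + 1)) := by
      rw [show 2 / (F₀ * N * ((j : ℝ) + 1)) = 2 / (F₀ * N) * (1 / ((j : ℝ) + 1)) by field_simp]
      apply mul_le_mul_of_nonneg_left _ (by positivity)
      apply one_div_le_one_div_of_le (by positivity)
      nlinarith
    rw [e1, add_mul]; linarith
  refine (Finset.sum_le_sum step).trans ?_
  rw [← Finset.mul_sum]
  have h1 := inv_sqrt_sum (n + 1)
  have h2 : Real.sqrt (n + 1 : ℕ) ≤ Real.sqrt N := by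
    apply Real.sqrt_le_sqrt
    rw [← hNN]; push_cast; linarith
  calc _ ≤ (Real.sqrt (β / F₀) / Real.sqrt N + 2 / (F₀ * N)) * (2 * Real.sqrt N) := by
        apply mul_le_mul_of_nonneg_left _ (by positivity)
        linarith
    _ = 2 * Real.sqrt (β / F₀) + 4 * Real.sqrt N / (F₀ * N) := by field_simp; ring
    _ = _ := by
      congr 1
      rw [div_eq_div_iff (by positivity) (by positivity)]
      linear_combination 4 * F₀ * hs2

lemma var_core {β F : ℝ} (hβ : 0 < β) (hF : 0 < F) (n k : ℕ) (h2 : 2 ≤ k) (hk : k ≤ n + 2)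
    (a M δ : ℝ) (m : Fin (n + 1) → ℝ) (hδ : 0 < δ) (hδ1 : δ < 1) (hM0 : 0 ≤ M)
    (hM : (∫ x in Set.Ioi 0, (x - a) ^ 2 * cw β (F * ((k : ℝ) - 1)) x) ≤
      M * ∫ x in Set.Ioi 0, cw β (F * ((k : ℝ) - 1)) x)
    (hm : ∀ i, (∫ x in Set.Ioi 0, x * cw β (F * cc n i) x) ≤
      m i * ∫ x in Set.Ioi 0, cw β (F * cc n i) x)
    (hs : ∑ i, m i ≤ 1 - 2 * δ) :
    0 ≤ condVar β (n + 2) F k ∧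
      condVar β (n + 2) F k ≤ M / (Real.exp (-(β / δ)) * δ) := by
  obtain ⟨j, hj, hcoord⟩ := coord_gen n k h2 hk
  have hb : ∀ i, 0 < F * cc n i := by
    intro i
    apply mul_pos hF
    unfold cc
    split_ifs with h
    · positivity
    · exact_mod_cast Nat.pos_of_ne_zero fun h' => h (Fin.ext h')
  have hw : ∀ i, IntegrableOn (cw β (F * cc n i)) (Set.Ioi 0) := fun i => by
    simpa using cw_int hβ (hb i) 0
  have hup := redW_upper hβ (fun i => F * cc n i) hb j a M (by simpa [hj] using hM)
  have hlow := redW_lower hβ (fun i => F * cc n i) m hb hδ hδ1 hm hs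
  have hI : ∀ p : ℕ, IntegrableOn (fun u => u j ^ p * redW β (fun i => F * cc n i) u)
      (spx (Fin (n + 1))) := fun p =>
    redW_integrable hβ (fun i => F * cc n i) j (fun x => x ^ p) (by fun_prop) hw
      (cw_int hβ (hb j) p)
  have hexp : ∀ t : ℝ, ∫ u in spx (Fin (n + 1)), (u j - t) ^ 2 * redW β (fun i => F * cc n i) u =
      (∫ u in spx (Fin (n + 1)), u j ^ 2 * redW β (fun i => F * cc n i) u)
      - 2 * t * (∫ u in spx (Fin (n + 1)), u j ^ 1 * redW β (fun i => F * cc n i) u)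
      + t ^ 2 * (∫ u in spx (Fin (n + 1)), u j ^ 0 * redW β (fun i => F * cc n i) u) := by
    intro t
    rw [← integral_const_mul, ← integral_const_mul, ← integral_sub, ← integral_add]
    · congr 1; ext u; ring
    · exact (hI 2).sub ((hI 1).const_mul _)
    · exact (hI 0).const_mul _
    · exact hI 2
    · exact (hI 1).const_mul _
  have hnn : ∀ t : ℝ, 0 ≤ ∫ u in spx (Fin (n + 1)),
      (u j - t) ^ 2 * redW β (fun i => F * cc n i) u := fun t =>
    integral_nonneg fun u => mul_nonneg (sq_nonneg _) (redW_pos _ _ _).le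
  have hZ : 0 < ∏ i, ∫ x in Set.Ioi 0, cw β (F * cc n i) x :=
    Finset.prod_pos fun i _ => cw_Z_pos hβ (hb i)
  have hv : condVar β (n + 2) F k =
      (∫ u in spx (Fin (n + 1)), u j ^ 2 * redW β (fun i => F * cc n i) u) /
        (∫ u in spx (Fin (n + 1)), 1 * redW β (fun i => F * cc n i) u) -
      ((∫ u in spx (Fin (n + 1)), u j ^ 1 * redW β (fun i => F * cc n i) u) /
        (∫ u in spx (Fin (n + 1)), 1 * redW β (fun i => F * cc n i) u)) ^ 2 := by
    unfold condVar condMean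
    have i0 := int_eq β F n (fun _ => 1)
    have i1 := int_eq β F n (coulombCoord (n + 2) k)
    have i2 := int_eq β F n (fun x => coulombCoord (n + 2) k x ^ 2)
    simp only [hcoord] at i1 i2
    have e0 := (Real.exp_pos (-F)).ne'
    change coulombInt β F (n + 2) (fun x : Fin (n + 1) → ℝ => coulombCoord (n + 2) k x ^ 2) /
      coulombInt β F (n + 2) (fun _ : Fin (n + 1) → ℝ => 1) - (_ /
      coulombInt β F (n + 2) (fun _ : Fin (n + 1) → ℝ => 1)) ^ 2 = _
    rw [i0, i1, i2, mul_div_mul_left _ _ e0, mul_div_mul_left _ _ e0]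
    simp only [pow_one]
  rw [hv]
  have hupa := hup
  rw [hexp a] at hupa
  have hnn' := fun t => (hexp t).symm ▸ hnn t
  simp only [pow_zero] at hnn' hupa
  clear hup hexp hnn hv hI
  generalize (∫ u in spx (Fin (n + 1)), u j ^ 2 * redW β (fun i => F * cc n i) u) = A2 at *
  generalize (∫ u in spx (Fin (n + 1)), u j ^ 1 * redW β (fun i => F * cc n i) u) = A1 at *
  generalize (∫ u in spx (Fin (n + 1)), 1 * redW β (fun i => F * cc n i) u) = A0 at *
  generalize (∏ i, ∫ x in Set.Ioi 0, cw β (F * cc n i) x) = Z at *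
  have hc : 0 < Real.exp (-(β / δ)) * δ := by positivity
  generalize Real.exp (-(β / δ)) * δ = c at *
  have hA0 : 0 < A0 := lt_of_lt_of_le (by positivity) hlow
  have id1 : ∀ t, A2 / A0 - (A1 / A0) ^ 2 = (A2 - 2 * t * A1 + t ^ 2 * A0) / A0 - (A1 / A0 - t) ^ 2 := by
    intro t; field_simp; ring
  constructor
  · rw [id1 (A1 / A0)]
    simp only [sub_self]
    have := div_nonneg (hnn' (A1 / A0)) hA0.le
    linarith
  · rw [id1 a]
    have h1 : (A2 - 2 * a * A1 + a ^ 2 * A0) / A0 ≤ M / c := by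
      rw [div_le_div_iff₀ hA0 hc]
      calc _ ≤ (M * Z) * c := by gcongr
        _ = M * (c * Z) := by ring
        _ ≤ _ := by gcongr
    linarith [sq_nonneg (A1 / A0 - a)]

/-- Weak supercritical force `F = F₀N`, `F₀ > 4β`: for `k ≥ 2` the conditional variance is
`O((kN)^{−3/2})`. -/
theorem var_spacing_supercritical (β F₀ : ℝ) (hβ : 0 < β) (hF₀ : 4 * β < F₀) :
    ∃ C > (0:ℝ), ∃ N₀ : ℕ, ∀ N ≥ N₀, ∀ k : ℕ, 2 ≤ k → k ≤ N →
      0 ≤ condVar β N (F₀ * N) k ∧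
      condVar β N (F₀ * N) k ≤ C * ((k : ℝ) * N) ^ (-(3:ℝ)/2) := by
  have hF : 0 < F₀ := by linarith
  have hθ0 : 0 ≤ Real.sqrt (β / F₀) := Real.sqrt_nonneg _
  have hθ : 2 * Real.sqrt (β / F₀) < 1 := by
    have : Real.sqrt (β / F₀) < 1 / 2 := by
      rw [Real.sqrt_lt' (by norm_num), div_lt_iff₀ hF]; linarith
    linarith
  obtain ⟨δ, hδd⟩ : ∃ δ, δ = (1 - 2 * Real.sqrt (β / F₀)) / 3 := ⟨_, rfl⟩
  have hδ : 0 < δ := by rw [hδd]; linarith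
  have hδ1 : δ < 1 := by rw [hδd]; linarith
  obtain ⟨N₁, hN₁⟩ := exists_nat_ge ((4 / (F₀ * δ)) ^ 2)
  obtain ⟨N₂, hN₂⟩ := exists_nat_ge (1 / (β * F₀))
  have hsβ : 0 < Real.sqrt β := Real.sqrt_pos.mpr hβ
  have hr : 0 < (F₀ / 2) ^ (-(3:ℝ)/2) := Real.rpow_pos_of_pos (by positivity) _
  refine ⟨21 * Real.sqrt β * (F₀ / 2) ^ (-(3:ℝ)/2) / (Real.exp (-(β / δ)) * δ), by positivity,
    N₁ + N₂ + 2, ?_⟩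
  intro N hN k h2 hk
  obtain ⟨n, rfl⟩ : ∃ n, N = n + 2 := ⟨N - 2, by omega⟩
  have hNp : (0:ℝ) < (n + 2 : ℕ) := by positivity
  have hNa : (N₁ : ℝ) ≤ (n + 2 : ℕ) := by exact_mod_cast (by omega)
  have hNb : (N₂ : ℝ) ≤ (n + 2 : ℕ) := by exact_mod_cast (by omega)
  have hbig : 1 ≤ β * (F₀ * (n + 2 : ℕ)) := by
    have : 1 / (β * F₀) ≤ (n + 2 : ℕ) := hN₂.trans hNb
    rw [div_le_iff₀ (by positivity)] at this
    linarith
  have hsm : 4 / (F₀ * Real.sqrt (n + 2 : ℕ)) ≤ δ := by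
    have : 4 / (F₀ * δ) ≤ Real.sqrt (n + 2 : ℕ) := Real.le_sqrt_of_sq_le (hN₁.trans hNa)
    have hs : 0 < Real.sqrt (n + 2 : ℕ) := Real.sqrt_pos.mpr hNp
    rw [div_le_iff₀ (by positivity)] at this ⊢
    linarith
  have hone : ∀ c : ℝ, 1 ≤ c → let b := F₀ * (n + 2 : ℕ) * c
      (∫ x in Set.Ioi 0, x * cw β b x) ≤
        (Real.sqrt (β / b) + 2 / b) * (∫ x in Set.Ioi 0, cw β b x) ∧
      (∫ x in Set.Ioi 0, (x - Real.sqrt (β / b)) ^ 2 * cw β b x) ≤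
        (21 * Real.sqrt (β / b) / b) * ∫ x in Set.Ioi 0, cw β b x := by
    intro c hc b
    have hb : 0 < b := by positivity
    have hβb : 1 ≤ β * b := by
      have : β * (F₀ * (n + 2 : ℕ)) * 1 ≤ β * (F₀ * (n + 2 : ℕ)) * c := by gcongr
      simp only [b]; linarith
    have ha : 0 < Real.sqrt (β / b) := Real.sqrt_pos.mpr (by positivity)
    have hab : Real.sqrt (β / b) ^ 2 * b = β := by
      rw [Real.sq_sqrt (by positivity)]; field_simp
    refine cw_main hβ hb ha hab ?_
    have h1 : (Real.sqrt (β / b) * b) ^ 2 = β * b := by linear_combination b * hab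
    by_contra hlt
    push Not at hlt
    have : 0 < Real.sqrt (β / b) * b := by positivity
    nlinarith
  have hk2 : (2:ℝ) ≤ k := by exact_mod_cast h2
  have hk1 : (1:ℝ) ≤ (k:ℝ) - 1 := by linarith
  have hcc : ∀ i, 1 ≤ cc n i := by
    intro i
    unfold cc
    split_ifs with h
    · have : (0:ℝ) ≤ n := by positivity
      linarith
    · exact_mod_cast Nat.pos_of_ne_zero fun h' => h (Fin.ext h')
  have hkb := (hone _ hk1).2
  have hb : 0 < F₀ * (n + 2 : ℕ) * ((k:ℝ) - 1) := by positivity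
  have main := var_core hβ (F := F₀ * (n + 2 : ℕ)) (by positivity) n k h2 hk _ _ δ _ hδ hδ1
    (by positivity) hkb (fun i => (hone _ (hcc i)).1)
    ((mean_sum hβ hF n).trans (by rw [hδd] at hsm ⊢; linarith))
  refine ⟨main.1, main.2.trans ?_⟩
  rw [div_mul_eq_mul_div]
  apply div_le_div_of_nonneg_right _ (by positivity)
  have hkN : 0 < (k:ℝ) * (n + 2 : ℕ) := by positivity
  rw [mul_assoc (21 * Real.sqrt β), ← Real.mul_rpow (by positivity) hkN.le]
  have hle : F₀ / 2 * ((k:ℝ) * (n + 2 : ℕ)) ≤ F₀ * (n + 2 : ℕ) * ((k:ℝ) - 1) := by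
    have : 0 ≤ F₀ * (n + 2 : ℕ) * ((k:ℝ) - 2) := by
      apply mul_nonneg (by positivity); linarith
    linarith
  have hrp := Real.rpow_le_rpow_of_nonpos (z := -(3:ℝ)/2) (by positivity) hle (by norm_num)
  generalize F₀ * (n + 2 : ℕ) * ((k:ℝ) - 1) = b at *
  have e : 21 * Real.sqrt (β / b) / b = 21 * Real.sqrt β * b ^ (-(3:ℝ)/2) := by
    rw [Real.sqrt_div hβ.le, Real.sqrt_eq_rpow b, show -(3:ℝ)/2 = -(1/2) + -1 by norm_num,
      Real.rpow_add hb, Real.rpow_neg hb.le, Real.rpow_neg_one]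
    ring
  rw [e]
  gcongr
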